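/- arXiv:1612.00597 — 2 statements merged into one kernel-verified Lean document; each statement's English description precedes it below -/
import Mathlib

section
/- If f(z) = Σ_{n=0}^∞ a_n z^n is analytic and bounded in the open unit disk 𝔻, then the alternating series A_f(r) = Σ_{k=0}^∞ (−1)^k |a_k| r^k satisfies |A_f(r)| ≤ ‖f‖_∞ for all 0 ≤ r ≤ 1/√3. -/
open Complex in
theorem integral_exp_int_mul_I (l : ℤ) :
    ∫ θ in (0 : ℝ)..2 * Real.pi, exp (l * θ * I) = if l = 0 then 2 * (Real.pi : ℂ) else 0 := by
  split_ifs with h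
  · simp [h]
  · have hc : (l : ℂ) * I ≠ 0 := mul_ne_zero (by exact_mod_cast h) I_ne_zero
    have h1 := integral_exp_mul_complex (a := 0) (b := 2 * Real.pi) hc
    have h2 : exp ((l : ℂ) * I * ((2 * Real.pi : ℝ) : ℂ)) = 1 := by
      rw [exp_eq_one_iff]
      exact ⟨l, by push_cast; ring⟩
    rw [h2] at h1
    simp only [ofReal_zero, mul_zero, exp_zero, sub_self, zero_div] at h1
    rw [← h1]
    congr 1
    ext θ
    ring_nf

open Complex in
theorem hasSum_integral_circle_mul_exp {a : ℕ → ℂ} {f : ℂ → ℂ} {R : ℝ}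
    (hsum : Summable fun k => ‖a k‖ * R ^ k) (hR : 0 ≤ R)
    (hf : ∀ θ : ℝ, HasSum (fun k => a k * (R * exp (θ * I)) ^ k) (f (R * exp (θ * I)))) (m : ℤ) :
    HasSum (fun k : ℕ => a k * R ^ k * (if (k : ℤ) = m then 2 * (Real.pi : ℂ) else 0))
      (∫ θ in (0 : ℝ)..2 * Real.pi, f (R * exp (θ * I)) * exp (-m * θ * I)) := by
  have hterm (k : ℕ) (θ : ℝ) : a k * (R * exp (θ * I)) ^ k * exp (-m * θ * I) =
      a k * R ^ k * exp (((k - m : ℤ) : ℂ) * θ * I) := by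
    rw [mul_pow, ← exp_nat_mul, mul_assoc, mul_assoc, ← exp_add, ← mul_assoc]
    congr 2
    push_cast
    ring
  have key := intervalIntegral.hasSum_integral_of_dominated_convergence
    (μ := MeasureTheory.volume) (a := (0 : ℝ)) (b := 2 * Real.pi)
    (F := fun (k : ℕ) (θ : ℝ) => a k * (R * exp (θ * I)) ^ k * exp (-m * θ * I))
    (f := fun θ : ℝ => f (R * exp (θ * I)) * exp (-m * θ * I))
    (fun k _ => ‖a k‖ * R ^ k)
    (fun k => by
      refine Continuous.aestronglyMeasurable ?_
      fun_prop)
    (fun k => .of_forall fun θ _ => by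
      have h : ‖exp (((k - m : ℤ) : ℂ) * θ * I)‖ = 1 := by
        simpa using norm_exp_ofReal_mul_I (((k - m : ℤ) : ℝ) * θ)
      rw [hterm, norm_mul, h]
      simp [abs_of_nonneg hR])
    (.of_forall fun θ _ => hsum)
    (by simp)
    (.of_forall fun θ _ => (hf θ).mul_right _)
  simpa only [hterm, intervalIntegral.integral_const_mul, integral_exp_int_mul_I, sub_eq_zero]
    using key

open Complex in
theorem norm_coeff_add_half_norm_coeff_mul_pow_le {a : ℕ → ℂ} {f : ℂ → ℂ} {C R : ℝ}
    (hsum : Summable fun k => ‖a k‖ * R ^ k) (hR : 0 ≤ R)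
    (hf : ∀ θ : ℝ, HasSum (fun k => a k * (R * exp (θ * I)) ^ k) (f (R * exp (θ * I))))
    (hC : ∀ θ : ℝ, ‖f (R * exp (θ * I))‖ ≤ C) {j n : ℕ} (hjn : j < n) :
    ‖a j‖ * R ^ j + ‖a (j + n)‖ * R ^ (j + n) / 2 ≤ C := by
  have hcont : Continuous fun θ : ℝ => f (R * exp (θ * I)) := by
    have h : (fun θ : ℝ => f (R * exp (θ * I))) =
        fun θ : ℝ => ∑' k, a k * (R * exp (θ * I)) ^ k := by
      ext θ
      exact (hf θ).tsum_eq.symm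
    rw [h]
    refine continuous_tsum (fun k => by fun_prop) hsum fun k θ => ?_
    simp [norm_exp_ofReal_mul_I, abs_of_nonneg hR]
  have hmul (w : ℂ) : Continuous fun θ : ℝ => f (R * exp (θ * I)) * exp (w * θ * I) :=
    hcont.mul (by fun_prop)
  have hcoeff (k : ℕ) : ∫ θ in (0 : ℝ)..2 * Real.pi, f (R * exp (θ * I)) * exp (-(k : ℤ) * θ * I) =
      a k * R ^ k * (2 * Real.pi) := by
    refine (hasSum_integral_circle_mul_exp hsum hR hf k).unique ?_
    convert hasSum_single k (f := fun l : ℕ => a l * (R : ℂ) ^ l *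
      (if (l : ℤ) = (k : ℤ) then 2 * (Real.pi : ℂ) else 0)) ?_ using 1
    · simp
    · intro l hl
      simp [hl]
  have hneg : ∫ θ in (0 : ℝ)..2 * Real.pi,
      f (R * exp (θ * I)) * exp (-((j - n : ℤ) : ℂ) * θ * I) = 0 := by
    refine (hasSum_integral_circle_mul_exp hsum hR hf (j - n)).unique ?_
    convert hasSum_zero using 2 with k
    rw [if_neg (by omega), mul_zero]
  set t : ℝ := arg (a j) - arg (a (j + n)) with ht
  have hK (θ : ℝ) : f (R * exp (θ * I)) * (exp (-(j : ℤ) * θ * I) * (1 + Real.cos (t - n * θ))) =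
      f (R * exp (θ * I)) * exp (-(j : ℤ) * θ * I) +
      exp (t * I) / 2 * (f (R * exp (θ * I)) * exp (-((j + n : ℕ) : ℤ) * θ * I)) +
      exp (-t * I) / 2 * (f (R * exp (θ * I)) * exp (-((j - n : ℤ) : ℂ) * θ * I)) := by
    have e1 : exp (-((j + n : ℕ) : ℤ) * θ * I) = exp (-(j : ℤ) * θ * I) * exp (-(n * θ) * I) := by
      rw [← exp_add]; congr 1; push_cast; ring
    have e2 : exp (-((j - n : ℤ) : ℂ) * θ * I) = exp (-(j : ℤ) * θ * I) * exp ((n * θ) * I) := by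
      rw [← exp_add]; congr 1; push_cast; ring
    have e3 : exp (((t : ℂ) - n * θ) * I) = exp (t * I) * exp (-(n * θ) * I) := by
      rw [← exp_add]; congr 1; ring
    have e4 : exp (-((t : ℂ) - n * θ) * I) = exp (-t * I) * exp ((n * θ) * I) := by
      rw [← exp_add]; congr 1; ring
    rw [e1, e2]
    push_cast
    rw [Complex.cos, e3, e4]
    ring
  have hintegral : ∫ θ in (0 : ℝ)..2 * Real.pi,
      f (R * exp (θ * I)) * (exp (-(j : ℤ) * θ * I) * (1 + Real.cos (t - n * θ))) =
      (a j * R ^ j + exp (t * I) * (a (j + n) * R ^ (j + n)) / 2) * (2 * Real.pi) := by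
    simp_rw [hK]
    rw [intervalIntegral.integral_add, intervalIntegral.integral_add,
      intervalIntegral.integral_const_mul, intervalIntegral.integral_const_mul, hneg, hcoeff,
      hcoeff]
    · ring
    · exact (hmul _).intervalIntegrable _ _
    · exact ((hmul _).const_mul _).intervalIntegrable _ _
    · exact ((hmul _).add ((hmul _).const_mul _)).intervalIntegrable _ _
    · exact ((hmul _).const_mul _).intervalIntegrable _ _
  have hcos : ∫ θ in (0 : ℝ)..2 * Real.pi, C * (1 + Real.cos (t - n * θ)) = C * (2 * Real.pi) := by
    have hn : (n : ℝ) ≠ 0 := by exact_mod_cast (by omega : n ≠ 0)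
    rw [intervalIntegral.integral_const_mul, intervalIntegral.integral_add (by simp)
      (Continuous.intervalIntegrable (by fun_prop) _ _),
      intervalIntegral.integral_comp_sub_mul _ hn, integral_cos]
    simp [Real.sin_sub_nat_mul_two_pi]
  have hle : ‖∫ θ in (0 : ℝ)..2 * Real.pi,
      f (R * exp (θ * I)) * (exp (-(j : ℤ) * θ * I) * (1 + Real.cos (t - n * θ)))‖ ≤
      C * (2 * Real.pi) := by
    rw [← hcos]
    refine intervalIntegral.norm_integral_le_of_norm_le (by positivity)
      (.of_forall fun θ _ => ?_) (Continuous.intervalIntegrable (by fun_prop) _ _)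
    have h0 : 0 ≤ 1 + Real.cos (t - n * θ) := by linarith [Real.neg_one_le_cos (t - n * θ)]
    have h1 : ‖exp (-(j : ℤ) * θ * I)‖ = 1 := by
      simpa using norm_exp_ofReal_mul_I (-(j : ℝ) * θ)
    have h2 : ‖(1 + (Real.cos (t - n * θ) : ℂ))‖ = 1 + Real.cos (t - n * θ) := by
      rw [← ofReal_one, ← ofReal_add, norm_real, Real.norm_of_nonneg h0]
    rw [norm_mul, norm_mul, h1, h2, one_mul]
    exact mul_le_mul_of_nonneg_right (hC θ) h0
  have halign : a j * R ^ j + exp (t * I) * (a (j + n) * R ^ (j + n)) / 2 =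
      ((‖a j‖ * R ^ j + ‖a (j + n)‖ * R ^ (j + n) / 2 : ℝ) : ℂ) * exp (arg (a j) * I) := by
    have h1 := norm_mul_exp_arg_mul_I (a j)
    have h2 := norm_mul_exp_arg_mul_I (a (j + n))
    have h3 : exp (arg (a j) * I) = exp (t * I) * exp (arg (a (j + n)) * I) := by
      rw [← exp_add]; congr 1; rw [ht]; push_cast; ring
    push_cast
    linear_combination (-(R : ℂ) ^ j) * h1 - exp (t * I) * (R : ℂ) ^ (j + n) / 2 * h2 -
      (‖a (j + n)‖ : ℂ) * (R : ℂ) ^ (j + n) / 2 * h3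
  rw [hintegral, halign, norm_mul, norm_mul, norm_exp_ofReal_mul_I, norm_real,
    Real.norm_of_nonneg (by positivity), mul_one] at hle
  have h2pi : ‖(2 * Real.pi : ℂ)‖ = 2 * Real.pi := by
    simp [abs_of_pos Real.pi_pos]
  rw [h2pi] at hle
  exact le_of_mul_le_mul_right hle (by positivity)

theorem summable_norm_coeff_mul_pow {f : ℂ → ℂ} {a : ℕ → ℂ}
    (hrep : ∀ z : ℂ, ‖z‖ < 1 → HasSum (fun n : ℕ => a n * z ^ n) (f z))
    {r : ℝ} (hr0 : 0 ≤ r) (hr1 : r < 1) : Summable fun k => ‖a k‖ * r ^ k := by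
  have h := (hrep r (by simpa [abs_of_nonneg hr0] using hr1)).summable.norm
  simpa [abs_of_nonneg hr0] using h

open Filter Topology in
theorem norm_coeff_add_half_norm_coeff_le {f : ℂ → ℂ} {a : ℕ → ℂ} {C : ℝ}
    (hrep : ∀ z : ℂ, ‖z‖ < 1 → HasSum (fun n : ℕ => a n * z ^ n) (f z))
    (hbound : ∀ z : ℂ, ‖z‖ < 1 → ‖f z‖ ≤ C) {j n : ℕ} (hjn : j < n) :
    ‖a j‖ + ‖a (j + n)‖ / 2 ≤ C := by
  have hlim : Tendsto (fun R : ℝ => ‖a j‖ * R ^ j + ‖a (j + n)‖ * R ^ (j + n) / 2) (𝓝[<] 1)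
      (𝓝 (‖a j‖ + ‖a (j + n)‖ / 2)) := by
    have h : Continuous fun R : ℝ => ‖a j‖ * R ^ j + ‖a (j + n)‖ * R ^ (j + n) / 2 := by fun_prop
    simpa using (h.tendsto 1).mono_left nhdsWithin_le_nhds
  refine le_of_tendsto hlim ?_
  filter_upwards [Ioo_mem_nhdsLT (zero_lt_one' ℝ)] with R hR
  have hz (θ : ℝ) : ‖(R : ℂ) * Complex.exp (θ * Complex.I)‖ < 1 := by
    simpa [Complex.norm_exp_ofReal_mul_I, abs_of_pos hR.1] using hR.2
  exact norm_coeff_add_half_norm_coeff_mul_pow_le (summable_norm_coeff_mul_pow hrep hR.1.le hR.2)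
    hR.1.le (fun θ => hrep _ (hz θ)) (fun θ => hbound _ (hz θ)) hjn

/-- The summation step of Bohr's theorem, with radius `1 / 3`. -/
theorem tsum_mul_pow_le_of_add_half_le {b : ℕ → ℝ} {C ρ : ℝ} (hb : ∀ k, 0 ≤ b k)
    (h : ∀ k, b 0 + b (k + 1) / 2 ≤ C) (hρ0 : 0 ≤ ρ) (hρ : ρ ≤ 1 / 3)
    (hs : Summable fun k => b k * ρ ^ k) : ∑' k, b k * ρ ^ k ≤ C := by
  have hC : 0 ≤ C - b 0 := by linarith [h 0, hb 1]
  have hg : HasSum (fun k : ℕ => 2 * (C - b 0) / 3 * (1 / 3 : ℝ) ^ k) (C - b 0) := by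
    have hgeom := hasSum_geometric_of_lt_one (r := (1 / 3 : ℝ)) (by norm_num) (by norm_num)
    have hval : 2 * (C - b 0) / 3 * (1 - 1 / 3 : ℝ)⁻¹ = C - b 0 := by ring
    simpa only [hval] using hgeom.mul_left (2 * (C - b 0) / 3)
  have hle : ∑' k, b (k + 1) * ρ ^ (k + 1) ≤ C - b 0 := by
    rw [← hg.tsum_eq]
    refine ((summable_nat_add_iff 1).2 hs).tsum_le_tsum (fun k => ?_) hg.summable
    calc b (k + 1) * ρ ^ (k + 1) ≤ (2 * (C - b 0)) * (1 / 3) ^ (k + 1) := by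
          gcongr
          linarith [h k]
      _ = _ := by ring
  rw [hs.tsum_eq_zero_add]
  simp only [pow_zero, mul_one]
  linarith

/-- Bohr-type inequality for the alternating series: if `f z = ∑ aₙ zⁿ` is analytic
and bounded (by `C`) in the unit disk, then `|∑ (-1)ᵏ |aₖ| rᵏ| ≤ C` for
`0 ≤ r ≤ 1/√3`. -/
theorem bohr_alternating_series
    (f : ℂ → ℂ) (a : ℕ → ℂ) (C : ℝ)
    (hrep : ∀ z : ℂ, ‖z‖ < 1 → HasSum (fun n : ℕ => a n * z ^ n) (f z))
    (hbound : ∀ z : ℂ, ‖z‖ < 1 → ‖f z‖ ≤ C) :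
    ∀ r : ℝ, 0 ≤ r → r ≤ 1 / Real.sqrt 3 →
      |∑' k : ℕ, (-1 : ℝ) ^ k * ‖a k‖ * r ^ k| ≤ C := by
  intro r hr0 hr
  have hsq : r ^ 2 ≤ 1 / 3 := by
    calc r ^ 2 ≤ (1 / Real.sqrt 3) ^ 2 := by gcongr
      _ = 1 / 3 := by rw [div_pow, Real.sq_sqrt (by norm_num), one_pow]
  have hr1 : r < 1 := by nlinarith
  have hC : 0 ≤ C := (norm_nonneg _).trans (hbound 0 (by simp))
  have hs := summable_norm_coeff_mul_pow hrep hr0 hr1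
  have hse : Summable fun k => ‖a (2 * k)‖ * (r ^ 2) ^ k := by
    simpa [Function.comp_def, pow_mul] using
      hs.comp_injective (i := fun k : ℕ => 2 * k) fun x y h => by simpa using h
  have hso : Summable fun k => ‖a (2 * k + 1)‖ * (r ^ 2) ^ k := by
    rcases hr0.eq_or_lt with rfl | hpos
    · exact summable_of_ne_finset_zero (s := {0}) fun k hk => by simp_all
    · refine (summable_mul_left_iff hpos.ne').1 ?_
      refine (hs.comp_injective (i := fun k : ℕ => 2 * k + 1) fun x y h => by simpa using h).congr
        fun k => ?_
      simp only [Function.comp_apply, pow_succ, pow_mul]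
      ring
  have heven : ∑' k, ‖a (2 * k)‖ * (r ^ 2) ^ k ≤ C :=
    tsum_mul_pow_le_of_add_half_le (b := fun k => ‖a (2 * k)‖) (fun _ => norm_nonneg _)
      (fun k => by
        simpa using norm_coeff_add_half_norm_coeff_le hrep hbound
          (j := 0) (n := 2 * (k + 1)) (by omega)) (by positivity) hsq hse
  have hodd : ∑' k, ‖a (2 * k + 1)‖ * (r ^ 2) ^ k ≤ C :=
    tsum_mul_pow_le_of_add_half_le (b := fun k => ‖a (2 * k + 1)‖) (fun _ => norm_nonneg _)
      (fun k => by
        simpa [add_comm] using norm_coeff_add_half_norm_coeff_le hrep hbound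
          (j := 1) (n := 2 * (k + 1)) (by omega)) (by positivity) hsq hso
  have he0 : 0 ≤ ∑' k, ‖a (2 * k)‖ * (r ^ 2) ^ k := tsum_nonneg fun k => by positivity
  have ho0 : 0 ≤ ∑' k, ‖a (2 * k + 1)‖ * (r ^ 2) ^ k := tsum_nonneg fun k => by positivity
  have hsplit : ∑' k : ℕ, (-1 : ℝ) ^ k * ‖a k‖ * r ^ k =
      ∑' k, ‖a (2 * k)‖ * (r ^ 2) ^ k - r * ∑' k, ‖a (2 * k + 1)‖ * (r ^ 2) ^ k := by
    have hE (k : ℕ) : (-1 : ℝ) ^ (2 * k) * ‖a (2 * k)‖ * r ^ (2 * k) =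
        ‖a (2 * k)‖ * (r ^ 2) ^ k := by simp [pow_mul]
    have hO (k : ℕ) : (-1 : ℝ) ^ (2 * k + 1) * ‖a (2 * k + 1)‖ * r ^ (2 * k + 1) =
        -r * (‖a (2 * k + 1)‖ * (r ^ 2) ^ k) := by
      rw [pow_succ, pow_succ, pow_mul, pow_mul]
      ring
    rw [← tsum_even_add_odd (f := fun k : ℕ => (-1 : ℝ) ^ k * ‖a k‖ * r ^ k)]
    · simp_rw [hE, hO, tsum_mul_left]
      ring
    · simpa only [hE] using hse
    · simpa only [hO] using hso.mul_left (-r)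
  rw [hsplit, abs_le]
  constructor <;> nlinarith
end

section
/- Let n ≥ 1 be an integer. If f(z) = Σ_{k=0}^∞ a_{nk} z^{nk} is analytic in the open unit disk 𝔻 with |f(z)| ≤ 1 for all z ∈ 𝔻, then M_f(r) = Σ_{k=0}^∞ |a_{nk}| r^{nk} ≤ 1 for all 0 ≤ r ≤ 3^{−1/n}. Moreover, the radius 3^{−1/n} is best possible: for every r with 3^{−1/n} < r < 1 there exists such an f with M_f(r) > 1. -/
/-- The integral over a period of the exponential with integer frequency. -/
lemma integral_exp_int_mul_I_s5 (j : ℤ) :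
    ∫ t in (0 : ℝ)..2 * Real.pi, Complex.exp (j * t * Complex.I) =
      if j = 0 then 2 * Real.pi else 0 := by
  split_ifs with h
  · simp [h]
  · have hj : (j * Complex.I : ℂ) ≠ 0 := by simp [h]
    have := integral_exp_mul_complex (a := 0) (b := 2 * Real.pi) hj
    have e : ∀ t : ℝ, (j * t * Complex.I : ℂ) = j * Complex.I * t := fun t => by ring
    simp_rw [e]
    rw [this]
    have h1 : (j * Complex.I * ((2 * Real.pi : ℝ) : ℂ)) = j * (2 * Real.pi * Complex.I) := by
      push_cast; ring
    rw [h1, Complex.exp_int_mul_two_pi_mul_I]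
    simp

/-- The Fourier coefficient of an absolutely convergent one-sided trigonometric series. -/
lemma integral_tsum_exp_mul_exp {b : ℕ → ℂ} (hb : Summable fun m => ‖b m‖) (j : ℤ) :
    ∫ t in (0 : ℝ)..2 * Real.pi,
        (∑' m, b m * Complex.exp (m * t * Complex.I)) * Complex.exp (-j * t * Complex.I) =
      ∑' m : ℕ, if (m : ℤ) = j then b m * (2 * Real.pi) else 0 := by
  have hnorm (x t : ℝ) : ‖Complex.exp (x * t * Complex.I)‖ = 1 := by
    exact_mod_cast Complex.norm_exp_ofReal_mul_I (x * t)
  have key := intervalIntegral.hasSum_integral_of_dominated_convergence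
    (μ := MeasureTheory.volume) (a := 0) (b := 2 * Real.pi)
    (F := fun (m : ℕ) (t : ℝ) =>
      b m * Complex.exp (m * t * Complex.I) * Complex.exp (-j * t * Complex.I))
    (f := fun t : ℝ =>
      (∑' m, b m * Complex.exp (m * t * Complex.I)) * Complex.exp (-j * t * Complex.I))
    (fun m _ => ‖b m‖)
    (fun m => by
      apply Continuous.aestronglyMeasurable
      fun_prop)
    (fun m => Filter.Eventually.of_forall fun t _ => by
      have h1 := hnorm m t
      have h2 := hnorm (-j) t
      push_cast at h1 h2
      rw [norm_mul, norm_mul, h1, h2]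
      simp)
    (Filter.Eventually.of_forall fun t _ => hb)
    (by simp)
    (Filter.Eventually.of_forall fun t _ => by
      refine HasSum.mul_right _ (Summable.hasSum ?_)
      refine Summable.of_norm ?_
      refine hb.congr fun m => ?_
      have h1 := hnorm m t
      push_cast at h1
      rw [norm_mul, h1, mul_one])
  rw [← key.tsum_eq]
  refine tsum_congr fun m => ?_
  have e : ∀ t : ℝ,
      b m * Complex.exp (m * t * Complex.I) * Complex.exp (-j * t * Complex.I) =
        b m * Complex.exp (((m - j : ℤ) : ℂ) * t * Complex.I) := fun t => by
    rw [mul_assoc, ← Complex.exp_add]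
    push_cast
    ring_nf
  simp_rw [e]
  rw [intervalIntegral.integral_const_mul, integral_exp_int_mul_I_s5]
  simp only [sub_eq_zero]
  split_ifs <;> simp

/-- Testing a bounded one-sided trigonometric series against the nonnegative kernel
`1 + cos (k t + φ)`. -/
lemma norm_add_half_norm_le_one {b : ℕ → ℂ} (hb : Summable fun m => ‖b m‖)
    (hle : ∀ t : ℝ, ‖∑' m, b m * Complex.exp (m * t * Complex.I)‖ ≤ 1)
    {k : ℕ} (hk : k ≠ 0) : ‖b 0‖ + ‖b k‖ / 2 ≤ 1 := by
  set F : ℝ → ℂ := fun t => ∑' m, b m * Complex.exp (m * t * Complex.I) with hF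
  have hFc : Continuous F := by
    refine continuous_tsum (fun m => by fun_prop) hb fun m t => ?_
    have h1 := Complex.norm_exp_ofReal_mul_I (m * t)
    push_cast at h1
    rw [norm_mul, h1, mul_one]
  set φ : ℝ := (b 0).arg - (b k).arg with hφ
  have h0 : ∫ t in (0 : ℝ)..2 * Real.pi, F t = b 0 * (2 * Real.pi) := by
    have := integral_tsum_exp_mul_exp hb 0
    rw [tsum_eq_single 0 (fun m hm => by simp [hm])] at this
    simpa using this
  have hp : ∫ t in (0 : ℝ)..2 * Real.pi, F t * Complex.exp (-k * t * Complex.I) =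
      b k * (2 * Real.pi) := by
    have := integral_tsum_exp_mul_exp hb k
    rw [tsum_eq_single k (fun m hm => by simp [hm])] at this
    simpa using this
  have hm : ∫ t in (0 : ℝ)..2 * Real.pi, F t * Complex.exp (k * t * Complex.I) = 0 := by
    have := integral_tsum_exp_mul_exp hb (-k)
    have h2 : ∀ m : ℕ, ¬ ((m : ℤ) = -k) := fun m => by omega
    simpa [h2] using this
  have hc : ∀ t : ℝ, F t * ((1 + Real.cos (k * t - φ) : ℝ) : ℂ) =
      F t + Complex.exp (φ * Complex.I) / 2 * (F t * Complex.exp (-k * t * Complex.I)) +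
        Complex.exp (-φ * Complex.I) / 2 * (F t * Complex.exp (k * t * Complex.I)) := fun t => by
    have e1 : Complex.exp ((k * t - φ) * Complex.I) =
        Complex.exp (-φ * Complex.I) * Complex.exp (k * t * Complex.I) := by
      rw [← Complex.exp_add]; ring_nf
    have e2 : Complex.exp (-(k * t - φ) * Complex.I) =
        Complex.exp (φ * Complex.I) * Complex.exp (-k * t * Complex.I) := by
      rw [← Complex.exp_add]; ring_nf
    push_cast
    rw [Complex.cos, e1, e2]
    ring
  have hI : ∫ t in (0 : ℝ)..2 * Real.pi, F t * ((1 + Real.cos (k * t - φ) : ℝ) : ℂ) =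
      (b 0 + Complex.exp (φ * Complex.I) / 2 * b k) * (2 * Real.pi) := by
    simp_rw [hc]
    rw [intervalIntegral.integral_add, intervalIntegral.integral_add,
      intervalIntegral.integral_const_mul, intervalIntegral.integral_const_mul, h0, hp, hm]
    · ring
    all_goals exact Continuous.intervalIntegrable (by fun_prop) _ _
  have hcos : ∫ t in (0 : ℝ)..2 * Real.pi, (1 + Real.cos (k * t - φ)) = 2 * Real.pi := by
    have hk' : (k : ℝ) ≠ 0 := by exact_mod_cast hk
    rw [intervalIntegral.integral_add (Continuous.intervalIntegrable (by fun_prop) _ _)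
      (Continuous.intervalIntegrable (by fun_prop) _ _),
      intervalIntegral.integral_comp_mul_sub (fun x => Real.cos x) hk']
    simp [Real.sin_nat_mul_two_pi_sub]
  have hbound : ‖(b 0 + Complex.exp (φ * Complex.I) / 2 * b k) * (2 * Real.pi)‖ ≤ 2 * Real.pi := by
    rw [← hI]
    conv_rhs => rw [← hcos]
    refine intervalIntegral.norm_integral_le_of_norm_le Real.two_pi_pos.le
      (Filter.Eventually.of_forall fun t _ => ?_)
      (Continuous.intervalIntegrable (by fun_prop) _ _)
    have hn : 0 ≤ 1 + Real.cos (k * t - φ) := by linarith [Real.neg_one_le_cos (k * t - φ)]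
    rw [norm_mul, Complex.norm_real, Real.norm_of_nonneg hn]
    exact mul_le_of_le_one_left hn (hle t)
  have harg : b 0 + Complex.exp (φ * Complex.I) / 2 * b k =
      ((‖b 0‖ + ‖b k‖ / 2 : ℝ) : ℂ) * Complex.exp ((b 0).arg * Complex.I) := by
    have e : Complex.exp (φ * Complex.I) * Complex.exp ((b k).arg * Complex.I) =
        Complex.exp ((b 0).arg * Complex.I) := by
      rw [← Complex.exp_add, hφ]; push_cast; ring_nf
    have e0 := Complex.norm_mul_exp_arg_mul_I (b 0)
    have e1 := Complex.norm_mul_exp_arg_mul_I (b k)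
    push_cast
    linear_combination -e0 - Complex.exp (φ * Complex.I) / 2 * e1 + ‖b k‖ / 2 * e
  rw [harg, norm_mul, norm_mul, Complex.norm_exp_ofReal_mul_I, Complex.norm_real,
    Real.norm_of_nonneg (by positivity), mul_one] at hbound
  have h2 : ‖(2 * Real.pi : ℂ)‖ = 2 * Real.pi := by
    simp [abs_of_pos Real.pi_pos]
  rw [h2] at hbound
  exact le_of_mul_le_mul_right (by linarith) Real.two_pi_pos

/-- Coefficient estimate for an `n`-symmetric function bounded by one in the unit disk. -/
lemma norm_coeff_zero_add_half_norm_coeff_le_one {n : ℕ} (hn : n ≠ 0) {f : ℂ → ℂ} {a : ℕ → ℂ}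
    (hf : ∀ z : ℂ, ‖z‖ < 1 → HasSum (fun k : ℕ => a k * z ^ (n * k)) (f z))
    (hle : ∀ z : ℂ, ‖z‖ < 1 → ‖f z‖ ≤ 1) {k : ℕ} (hk : k ≠ 0) :
    ‖a 0‖ + ‖a k‖ / 2 ≤ 1 := by
  have hs : ∀ s : ℝ, s ∈ Set.Ioo (0 : ℝ) 1 → ‖a 0‖ + ‖a k‖ * s ^ (n * k) / 2 ≤ 1 := by
    rintro s ⟨hs0, hs1⟩
    have hsum : Summable fun m => ‖a m * (s : ℂ) ^ (n * m)‖ :=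
      (hf s (by simpa [abs_of_pos hs0] using hs1)).summable.norm
    have := norm_add_half_norm_le_one hsum (fun t => ?_) hk
    · simpa [abs_of_pos hs0] using this
    · set z : ℂ := s * Complex.exp ((t / n : ℝ) * Complex.I) with hz
      have hz1 : ‖z‖ < 1 := by
        rw [hz, norm_mul, Complex.norm_exp_ofReal_mul_I]
        simpa [abs_of_pos hs0] using hs1
      have hn' : (n : ℂ) ≠ 0 := by exact_mod_cast hn
      have e : ∀ m : ℕ, a m * (s : ℂ) ^ (n * m) * Complex.exp (m * t * Complex.I) =
          a m * z ^ (n * m) := fun m => by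
        rw [hz, mul_pow, ← Complex.exp_nat_mul, mul_assoc]
        congr 3
        push_cast
        field_simp
      simp_rw [e]
      rw [(hf z hz1).tsum_eq]
      exact hle z hz1
  have hlim : Filter.Tendsto (fun s : ℝ => ‖a 0‖ + ‖a k‖ * s ^ (n * k) / 2)
      (nhdsWithin 1 (Set.Iio 1)) (nhds (‖a 0‖ + ‖a k‖ / 2)) := by
    have hc : Continuous fun s : ℝ => ‖a 0‖ + ‖a k‖ * s ^ (n * k) / 2 := by fun_prop
    simpa using (hc.tendsto 1).mono_left nhdsWithin_le_nhds
  exact le_of_tendsto hlim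
    (Filter.eventually_of_mem (Ioo_mem_nhdsLT zero_lt_one) hs)

/-- The `n`-th power of the Bohr radius of `n`-symmetric functions. -/
lemma three_rpow_neg_one_div_pow {n : ℕ} (hn : n ≠ 0) :
    ((3 : ℝ) ^ (-(1 : ℝ) / n)) ^ n = 1 / 3 := by
  have hn' : (n : ℝ) ≠ 0 := by exact_mod_cast hn
  rw [← Real.rpow_mul_natCast (by norm_num), div_mul_cancel₀ _ hn', Real.rpow_neg_one]
  norm_num

/-- If every coefficient satisfies `‖a 0‖ + ‖a k‖ / 2 ≤ 1`, the majorant series is at most one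
up to radius `1 / 3`. -/
lemma tsum_norm_mul_pow_le_one {a : ℕ → ℂ} (ha : ∀ k, k ≠ 0 → ‖a 0‖ + ‖a k‖ / 2 ≤ 1) {q : ℝ}
    (hq0 : 0 ≤ q) (hq : q ≤ 1 / 3) : ∑' k, ‖a k‖ * q ^ k ≤ 1 := by
  have hterm : ∀ k, ‖a (k + 1)‖ * q ^ (k + 1) ≤ 2 * (1 - ‖a 0‖) / 3 * (1 / 3) ^ k := fun k => by
    have h1 := ha (k + 1) k.succ_ne_zero
    have h2 := norm_nonneg (a (k + 1))
    calc ‖a (k + 1)‖ * q ^ (k + 1) ≤ (2 * (1 - ‖a 0‖)) * (1 / 3) ^ (k + 1) := by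
          gcongr <;> linarith
      _ = _ := by ring
  have hgeom : HasSum (fun k : ℕ => 2 * (1 - ‖a 0‖) / 3 * (1 / 3 : ℝ) ^ k) (1 - ‖a 0‖) := by
    have e : 1 - ‖a 0‖ = 2 * (1 - ‖a 0‖) / 3 * (1 - 1 / 3)⁻¹ := by ring
    have h := (hasSum_geometric_of_lt_one (r := (1 / 3 : ℝ)) (by norm_num) (by norm_num)).mul_left
      (2 * (1 - ‖a 0‖) / 3)
    rwa [← e] at h
  have hsum : Summable fun k => ‖a (k + 1)‖ * q ^ (k + 1) :=
    Summable.of_nonneg_of_le (fun k => by positivity) hterm hgeom.summable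
  have hsum' : Summable fun k => ‖a k‖ * q ^ k := (summable_nat_add_iff 1).mp hsum
  rw [hsum'.tsum_eq_zero_add]
  have := hsum.tsum_le_tsum hterm hgeom.summable
  rw [hgeom.tsum_eq] at this
  simpa using by linarith

/-- The Taylor coefficients at the origin of the Blaschke factor `w ↦ (α - w) / (1 - α w)`. -/
def blaschkeCoeff (α : ℝ) : ℕ → ℝ
  | 0 => α
  | k + 1 => -((1 - α ^ 2) * α ^ k)

lemma hasSum_blaschkeCoeff {α : ℝ} (h0 : 0 ≤ α) (h1 : α < 1) {w : ℂ} (hw : ‖w‖ < 1) :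
    HasSum (fun k => (blaschkeCoeff α k : ℂ) * w ^ k) ((α - w) / (1 - α * w)) := by
  have hlt : ‖(α : ℂ) * w‖ < 1 := by
    rw [norm_mul, Complex.norm_real, Real.norm_of_nonneg h0]
    nlinarith [norm_nonneg w]
  have hne : 1 - (α : ℂ) * w ≠ 0 := by
    intro h
    rw [← sub_eq_zero.mp h] at hlt
    simp at hlt
  have h : HasSum (fun k => (blaschkeCoeff α (k + 1) : ℂ) * w ^ (k + 1))
      (-(1 - (α : ℂ) ^ 2) * w * (1 - α * w)⁻¹) := by
    refine ((hasSum_geometric_of_norm_lt_one hlt).mul_left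
      (-(1 - (α : ℂ) ^ 2) * w)).congr_fun fun k => ?_
    simp only [blaschkeCoeff]
    push_cast
    ring
  have e : ((α : ℂ) - w) / (1 - α * w) =
      (blaschkeCoeff α 0 : ℂ) * w ^ 0 + -(1 - (α : ℂ) ^ 2) * w * (1 - α * w)⁻¹ := by
    simp only [blaschkeCoeff, pow_zero]
    field_simp
    ring
  rw [e]
  exact HasSum.zero_add (f := fun k => (blaschkeCoeff α k : ℂ) * w ^ k) h

lemma norm_blaschke_le_one {α : ℝ} (h0 : 0 ≤ α) (h1 : α < 1) {w : ℂ} (hw : ‖w‖ < 1) :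
    ‖((α : ℂ) - w) / (1 - α * w)‖ ≤ 1 := by
  rw [norm_div]
  refine div_le_one_of_le₀ ?_ (norm_nonneg _)
  rw [← sq_le_sq₀ (norm_nonneg _) (norm_nonneg _), Complex.sq_norm, Complex.sq_norm,
    Complex.normSq_apply, Complex.normSq_apply]
  have hw2 : w.re * w.re + w.im * w.im < 1 := by
    rw [← Complex.normSq_apply, ← Complex.sq_norm]
    nlinarith [norm_nonneg w]
  simp
  nlinarith [mul_nonneg (sub_nonneg.mpr hw2.le) (show 0 ≤ 1 - α ^ 2 by nlinarith)]

lemma hasSum_norm_blaschkeCoeff {α q : ℝ} (h0 : 0 ≤ α) (h1 : α < 1) (hq0 : 0 ≤ q) (hq1 : q < 1) :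
    HasSum (fun k => ‖(blaschkeCoeff α k : ℂ)‖ * q ^ k)
      (α + (1 - α ^ 2) * q / (1 - α * q)) := by
  have h2 : 0 ≤ 1 - α ^ 2 := by nlinarith
  have h : HasSum (fun k => ‖(blaschkeCoeff α (k + 1) : ℂ)‖ * q ^ (k + 1))
      ((1 - α ^ 2) * q * (1 - α * q)⁻¹) := by
    refine ((hasSum_geometric_of_lt_one (mul_nonneg h0 hq0) (by nlinarith)).mul_left
      _).congr_fun fun k => ?_
    rw [Complex.norm_real, blaschkeCoeff, norm_neg, Real.norm_of_nonneg (by positivity)]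
    ring
  have e : α + (1 - α ^ 2) * q / (1 - α * q) =
      ‖(blaschkeCoeff α 0 : ℂ)‖ * q ^ 0 + (1 - α ^ 2) * q * (1 - α * q)⁻¹ := by
    simp [blaschkeCoeff, abs_of_nonneg h0, div_eq_mul_inv]
  rw [e]
  exact h.zero_add

/-- Beyond radius `1 / 3` some Blaschke factor has majorant series exceeding one. -/
lemma exists_one_lt_tsum_norm_blaschkeCoeff {q : ℝ} (hq : 1 / 3 < q) (hq1 : q < 1) :
    ∃ α : ℝ, 0 ≤ α ∧ α < 1 ∧ 1 < ∑' k, ‖(blaschkeCoeff α k : ℂ)‖ * q ^ k := by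
  have hq0 : 0 < q := by linarith
  have hlt : (1 - q) / (2 * q) < 1 := by
    rw [div_lt_one (by positivity)]
    linarith
  obtain ⟨α, hα, hα1⟩ := exists_between hlt
  have h0 : 0 ≤ α := (div_nonneg (by linarith) (by positivity)).trans hα.le
  refine ⟨α, h0, hα1, ?_⟩
  rw [(hasSum_norm_blaschkeCoeff h0 hα1 hq0.le hq1).tsum_eq]
  rw [div_lt_iff₀ (by positivity)] at hα
  have hd : 0 < 1 - α * q := by nlinarith
  have : 1 - α < (1 - α ^ 2) * q / (1 - α * q) := by
    rw [lt_div_iff₀ hd]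
    nlinarith [mul_pos (sub_pos.mpr hα1) (show 0 < q * (1 + 2 * α) - 1 by linarith)]
  linarith

/-- Bohr inequality for `n`-symmetric functions, with sharpness: if
`f z = ∑_k a_{nk} z^{nk}` is analytic in the unit disk with `|f| ≤ 1`, then
`∑_k |a_{nk}| r^{nk} ≤ 1` for `0 ≤ r ≤ 3^{-1/n}`, and the radius `3^{-1/n}`
is best possible. Here `a k` denotes the coefficient of `z^{n k}`. -/
theorem bohr_n_symmetric (n : ℕ) (hn : 1 ≤ n) :
    (∀ (f : ℂ → ℂ) (a : ℕ → ℂ),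
      (∀ z : ℂ, ‖z‖ < 1 → HasSum (fun k : ℕ => a k * z ^ (n * k)) (f z)) →
      (∀ z : ℂ, ‖z‖ < 1 → ‖f z‖ ≤ 1) →
      ∀ r : ℝ, 0 ≤ r → r ≤ (3 : ℝ) ^ (-(1 : ℝ) / n) →
        ∑' k : ℕ, ‖a k‖ * r ^ (n * k) ≤ 1) ∧
    (∀ r : ℝ, (3 : ℝ) ^ (-(1 : ℝ) / n) < r → r < 1 →
      ∃ (f : ℂ → ℂ) (a : ℕ → ℂ),
        (∀ z : ℂ, ‖z‖ < 1 → HasSum (fun k : ℕ => a k * z ^ (n * k)) (f z)) ∧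
        (∀ z : ℂ, ‖z‖ < 1 → ‖f z‖ ≤ 1) ∧
        1 < ∑' k : ℕ, ‖a k‖ * r ^ (n * k)) := by
  have hn0 : n ≠ 0 := by omega
  refine ⟨fun f a hf hle r hr0 hr => ?_, fun r hr hr1 => ?_⟩
  · simp_rw [pow_mul]
    refine tsum_norm_mul_pow_le_one
      (fun k hk => norm_coeff_zero_add_half_norm_coeff_le_one hn0 hf hle hk) (by positivity) ?_
    rw [← three_rpow_neg_one_div_pow hn0]
    gcongr
  · have hq : 1 / 3 < r ^ n := by
      rw [← three_rpow_neg_one_div_pow hn0]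
      gcongr
    have hr0 : 0 ≤ r := (Real.rpow_nonneg (by norm_num) _).trans hr.le
    obtain ⟨α, h0, h1, hα⟩ :=
      exists_one_lt_tsum_norm_blaschkeCoeff hq (pow_lt_one₀ hr0 hr1 hn0)
    have hz (z : ℂ) (h : ‖z‖ < 1) : ‖z ^ n‖ < 1 := by
      rw [norm_pow]
      exact pow_lt_one₀ (norm_nonneg z) h hn0
    refine ⟨fun z => (α - z ^ n) / (1 - α * z ^ n), fun k => blaschkeCoeff α k,
      fun z h => ?_, fun z h => norm_blaschke_le_one h0 h1 (hz z h), ?_⟩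
    · simpa only [pow_mul] using hasSum_blaschkeCoeff h0 h1 (hz z h)
    · simpa only [pow_mul] using hα
end
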